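/- For |q|<1, the 3-dissection (-q;q)_∞/(q;q)_∞ = J₁₈¹²/(J_{3,18}⁸ J₆⁴ J_{9,18}) + 2q·J₁₈¹²/(J_{3,18}⁷ J₆⁴ J_{9,18}²) + 4q²·J₁₈¹²/(J_{3,18}⁶ J₆⁴ J_{9,18}³) holds. -/

import Mathlib

open scoped BigOperators

noncomputable def poch (a q : ℂ) : ℂ := ∏' n : ℕ, (1 - a * q ^ n)

noncomputable def Jm (m : ℕ) (q : ℂ) : ℂ := poch (q ^ m) (q ^ m)

noncomputable def Jam (a m : ℕ) (q : ℂ) : ℂ :=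
  poch (q ^ a) (q ^ m) * poch (q ^ (m - a)) (q ^ m) * poch (q ^ m) (q ^ m)

noncomputable def Sser (a Q : ℂ) : ℂ :=
  ∑' n : ℕ, (1 / (1 - a * Q ^ n) - 1 / (1 - a⁻¹ * Q ^ (n + 1)))

open Filter Topology Finset

/-- Partial products of `poch`. -/
noncomputable def finPoch (a q : ℂ) (n : ℕ) : ℂ := ∏ k ∈ range n, (1 - a * q ^ k)

lemma summable_norm_mul_pow (a : ℂ) {q : ℂ} (hq : ‖q‖ < 1) :
    Summable fun n : ℕ => ‖-(a * q ^ n)‖ := by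
  simpa [norm_mul, norm_pow] using
    (summable_geometric_of_lt_one (norm_nonneg q) hq).mul_left ‖a‖

lemma tendsto_finPoch (a : ℂ) {q : ℂ} (hq : ‖q‖ < 1) :
    Tendsto (finPoch a q) atTop (𝓝 (poch a q)) := by
  have h := multipliable_one_add_of_summable (summable_norm_mul_pow a hq)
  simpa only [← sub_eq_add_neg] using! h.hasProd.tendsto_prod_nat

lemma one_sub_mul_pow_ne_zero {a q : ℂ} (ha : ‖a‖ < 1) (hq : ‖q‖ < 1) (n : ℕ) :
    1 - a * q ^ n ≠ 0 := by
  intro h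
  have h1 : ‖a * q ^ n‖ = 1 := by rw [← sub_eq_zero.mp h, norm_one]
  rw [norm_mul, norm_pow] at h1
  have h2 : ‖q‖ ^ n ≤ 1 := pow_le_one₀ (norm_nonneg _) hq.le
  nlinarith [norm_nonneg a]

lemma poch_ne_zero {a q : ℂ} (ha : ‖a‖ < 1) (hq : ‖q‖ < 1) : poch a q ≠ 0 := by
  have := tprod_one_add_ne_zero_of_summable (f := fun n : ℕ => -(a * q ^ n))
    (fun n => by simpa [← sub_eq_add_neg] using one_sub_mul_pow_ne_zero ha hq n)
    (summable_norm_mul_pow a hq)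
  simpa [← sub_eq_add_neg, poch] using this

lemma finPoch_ne_zero {a q : ℂ} (ha : ‖a‖ < 1) (hq : ‖q‖ < 1) (n : ℕ) : finPoch a q n ≠ 0 :=
  prod_ne_zero_iff.mpr fun k _ => one_sub_mul_pow_ne_zero ha hq k

lemma norm_pow_lt_one {q : ℂ} (hq : ‖q‖ < 1) {m : ℕ} (hm : m ≠ 0) : ‖q ^ m‖ < 1 := by
  rw [norm_pow]; exact pow_lt_one₀ (norm_nonneg _) hq hm

lemma finPoch_succ (a q : ℂ) (n : ℕ) :
    finPoch a q (n + 1) = finPoch a q n * (1 - a * q ^ n) := prod_range_succ _ _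

/-- The dissection of a `q`-Pochhammer symbol by the residue of the index modulo `m`. -/
lemma poch_dissection (a : ℂ) {q : ℂ} (hq : ‖q‖ < 1) {m : ℕ} (hm : m ≠ 0) :
    poch a q = ∏ r ∈ range m, poch (a * q ^ r) (q ^ m) := by
  have h1 : Tendsto (fun n => finPoch a q (m * n)) atTop (𝓝 (poch a q)) :=
    (tendsto_finPoch a hq).comp (tendsto_id.const_mul_atTop' (Nat.pos_of_ne_zero hm))
  have h2 : Tendsto (fun n => ∏ r ∈ range m, finPoch (a * q ^ r) (q ^ m) n) atTop
      (𝓝 (∏ r ∈ range m, poch (a * q ^ r) (q ^ m))) :=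
    tendsto_finsetProd _ fun r _ => tendsto_finPoch _ (norm_pow_lt_one hq hm)
  refine tendsto_nhds_unique h1 (h2.congr fun n => ?_)
  induction n with
  | zero => simp [finPoch]
  | succ n ih =>
    simp_rw [finPoch_succ, prod_mul_distrib, ih]
    rw [mul_add_one, finPoch, finPoch, prod_range_add]
    congr 1
    exact prod_congr rfl fun r _ => by ring

lemma poch_mul_poch_neg (a : ℂ) {q : ℂ} (hq : ‖q‖ < 1) :
    poch a q * poch (-a) q = poch (a ^ 2) (q ^ 2) := by
  refine tendsto_nhds_unique ((tendsto_finPoch a hq).mul (tendsto_finPoch (-a) hq))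
    ((tendsto_finPoch (a ^ 2) (norm_pow_lt_one hq two_ne_zero)).congr fun n => ?_)
  simp_rw [finPoch, ← prod_mul_distrib]
  exact prod_congr rfl fun r _ => by ring

lemma poch_mul_cube_roots (a : ℂ) {q w : ℂ} (hq : ‖q‖ < 1) (hw : 1 + w + w ^ 2 = 0) :
    poch a q * poch (w * a) q * poch (w ^ 2 * a) q = poch (a ^ 3) (q ^ 3) := by
  refine tendsto_nhds_unique (((tendsto_finPoch a hq).mul (tendsto_finPoch _ hq)).mul
    (tendsto_finPoch _ hq))
    ((tendsto_finPoch (a ^ 3) (norm_pow_lt_one hq three_ne_zero)).congr fun n => ?_)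
  simp_rw [finPoch, ← prod_mul_distrib]
  refine prod_congr rfl fun r _ => ?_
  linear_combination (a * q ^ r - w * (a * q ^ r) ^ 2 + (w - 1) * (a * q ^ r) ^ 3) * hw

/-- The Gaussian binomial coefficients, defined by their `q`-Pascal recurrence. -/
noncomputable def gaussBinom (q : ℂ) : ℕ → ℕ → ℂ
  | _, 0 => 1
  | 0, _ + 1 => 0
  | n + 1, k + 1 => gaussBinom q n k + q ^ (k + 1) * gaussBinom q n (k + 1)

lemma gaussBinom_zero_right (q : ℂ) (n : ℕ) : gaussBinom q n 0 = 1 := by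
  cases n <;> rfl

lemma gaussBinom_eq_zero (q : ℂ) {n k : ℕ} (h : n < k) : gaussBinom q n k = 0 := by
  induction n generalizing k with
  | zero => obtain ⟨k, rfl⟩ := Nat.exists_eq_add_of_lt h; simp [gaussBinom]
  | succ n ih =>
    obtain ⟨k, rfl⟩ : ∃ j, k = j + 1 := ⟨k - 1, by omega⟩
    rw [gaussBinom, ih (by omega), ih (by omega)]; simp

lemma gaussBinom_mul (q : ℂ) (k l : ℕ) :
    gaussBinom q (k + l) k * (finPoch q q k * finPoch q q l) = finPoch q q (k + l) := by
  induction k generalizing l with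
  | zero => simp [gaussBinom_zero_right, finPoch]
  | succ k ihk =>
    induction l with
    | zero =>
      have := ihk 0
      simp only [add_zero] at this ⊢
      rw [gaussBinom, gaussBinom_eq_zero q (Nat.lt_succ_self k), finPoch_succ]
      linear_combination (1 - q * q ^ k) * this
    | succ l ihl =>
      have h1 := ihk (l + 1)
      have e : k + 1 + (l + 1) = (k + 1 + l) + 1 := by ring
      rw [e, gaussBinom, finPoch_succ q q (k + 1 + l)]
      rw [show k + (l + 1) = k + 1 + l by ring] at h1
      rw [finPoch_succ q q k, finPoch_succ q q l] at *
      rw [pow_add, pow_succ]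
      linear_combination (1 - q * q ^ k) * h1 + q ^ (k + 1) * (1 - q * q ^ l) * ihl

/-- The `q`-binomial theorem. -/
lemma finPoch_neg_eq_sum (q x : ℂ) (n : ℕ) :
    finPoch (-x) q n = ∑ k ∈ range (n + 1), gaussBinom q n k * q ^ k.choose 2 * x ^ k := by
  induction n generalizing x with
  | zero => simp [finPoch, gaussBinom]
  | succ n ih =>
    have h : finPoch (-x) q (n + 1) = (1 + x) * finPoch (-(x * q)) q n := by
      rw [finPoch, prod_range_succ', mul_comm, finPoch]
      congr 1
      · simp
      · exact prod_congr rfl fun r _ => by ring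
    have h2 : ∑ k ∈ range (n + 1), gaussBinom q n k * q ^ k.choose 2 * (x * q) ^ k
        = 1 + ∑ k ∈ range (n + 1),
          gaussBinom q n (k + 1) * q ^ (k + 1).choose 2 * (x * q) ^ (k + 1) := by
      rw [sum_range_succ', sum_range_succ _ n, gaussBinom_eq_zero q (Nat.lt_succ_self n)]
      simp [gaussBinom_zero_right, add_comm]
    rw [h, ih, add_mul, one_mul]
    nth_rewrite 1 [h2]
    rw [sum_range_succ' _ (n + 1), mul_sum, add_assoc, ← sum_add_distrib, add_comm]
    congr 1
    · refine sum_congr rfl fun k _ => ?_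
      have : (k + 1).choose 2 = k + k.choose 2 := by
        rw [Nat.choose_succ_succ' k 1, Nat.choose_one_right]
      rw [gaussBinom, this]
      ring
    · simp [gaussBinom_zero_right]

/-- The summand of Jacobi's theta series. -/
noncomputable def thetaTerm (z q : ℂ) (n : ℤ) : ℂ := (-1) ^ n * z ^ n * q ^ (n ^ 2)

lemma summable_thetaTerm {z q : ℂ} (hz : z ≠ 0) (hq0 : q ≠ 0) (hq : ‖q‖ < 1) :
    Summable (thetaTerm z q) := by
  have hpi : (Real.pi : ℂ) ≠ 0 := by exact_mod_cast Real.pi_ne_zero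
  have hI := Complex.I_ne_zero
  have him : 0 < (Complex.log q / (Real.pi * Complex.I)).im := by
    have : Complex.log q / (Real.pi * Complex.I)
        = ((Real.pi⁻¹ : ℝ) : ℂ) * (-(Complex.I * Complex.log q)) := by
      push_cast; field_simp; rw [Complex.I_sq]; ring
    rw [this, Complex.im_ofReal_mul]
    have h2 : Real.log ‖q‖ < 0 := Real.log_neg (norm_pos_iff.mpr hq0) hq
    simp [Complex.log_re]
    exact mul_neg_of_pos_of_neg (inv_pos.mpr Real.pi_pos) h2
  refine ((summable_jacobiTheta₂_term_iff
    (Complex.log (-z) / (2 * Real.pi * Complex.I)) _).mpr him).congr fun n => ?_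
  have e1 : 2 * Real.pi * Complex.I * n * (Complex.log (-z) / (2 * Real.pi * Complex.I))
      + Real.pi * Complex.I * (n : ℂ) ^ 2 * (Complex.log q / (Real.pi * Complex.I))
      = (n : ℤ) * Complex.log (-z) + (n ^ 2 : ℤ) * Complex.log q := by
    push_cast; field_simp
  rw [jacobiTheta₂_term, e1, Complex.exp_add, Complex.exp_int_mul, Complex.exp_int_mul,
    Complex.exp_log (neg_ne_zero.mpr hz), Complex.exp_log hq0, thetaTerm, ← mul_zpow, neg_one_mul]

/-- The coefficients of the finite form of the triple product. -/
noncomputable def tripleCoeff (q : ℂ) (n : ℕ) (j : ℤ) : ℂ :=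
  if -n ≤ j then gaussBinom q (2 * n) (j + n).toNat else 0

lemma prod_range_reflected (z : ℂ) {q : ℂ} (hz : z ≠ 0) (hq0 : q ≠ 0) (n : ℕ) :
    finPoch (z * q * (q ^ (2 * n))⁻¹) (q ^ 2) n
      = (-1) ^ n * z ^ n * (q ^ (n ^ 2))⁻¹ * finPoch (z⁻¹ * q) (q ^ 2) n := by
  induction n with
  | zero => simp [finPoch]
  | succ n ih =>
    have : finPoch (z * q * (q ^ (2 * (n + 1)))⁻¹) (q ^ 2) (n + 1)
        = (1 - z * q * (q ^ (2 * (n + 1)))⁻¹) * finPoch (z * q * (q ^ (2 * n))⁻¹) (q ^ 2) n := by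
      rw [finPoch, prod_range_succ', mul_comm, finPoch]
      congr 1
      · simp
      · refine prod_congr rfl fun r _ => ?_
        field_simp
        ring
    rw [this, ih, finPoch_succ]
    field_simp
    ring

/-- The finite form of the Jacobi triple product. -/
lemma finPoch_mul_finPoch {z q : ℂ} (hz : z ≠ 0) (hq0 : q ≠ 0) (n : ℕ) :
    finPoch (z * q) (q ^ 2) n * finPoch (z⁻¹ * q) (q ^ 2) n
      = ∑' j : ℤ, tripleCoeff (q ^ 2) n j * thetaTerm z q j := by
  have h1 : finPoch (z * q * (q ^ (2 * n))⁻¹) (q ^ 2) (2 * n)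
      = finPoch (z * q * (q ^ (2 * n))⁻¹) (q ^ 2) n * finPoch (z * q) (q ^ 2) n := by
    rw [two_mul n, finPoch, prod_range_add]
    congr 1
    refine prod_congr rfl fun r _ => ?_
    field_simp
    ring
  have h2 := finPoch_neg_eq_sum (q ^ 2) (-(z * q * (q ^ (2 * n))⁻¹)) (2 * n)
  rw [neg_neg, h1, prod_range_reflected z hz hq0] at h2
  have h3 : finPoch (z * q) (q ^ 2) n * finPoch (z⁻¹ * q) (q ^ 2) n
      = (-1) ^ n * (z ^ n)⁻¹ * q ^ (n ^ 2) * ∑ k ∈ range (2 * n + 1),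
        gaussBinom (q ^ 2) (2 * n) k * (q ^ 2) ^ k.choose 2
          * (-(z * q * (q ^ (2 * n))⁻¹)) ^ k := by
    rw [← h2]
    have : ((-1 : ℂ) ^ n) * (-1) ^ n = 1 := by rw [← mul_pow]; simp
    field_simp
    linear_combination -(finPoch (z * q) (q ^ 2) n * finPoch (q / z) (q ^ 2) n) * this
  have hsub : ∑' j : ℤ, tripleCoeff (q ^ 2) n j * thetaTerm z q j
      = ∑' k : ℕ, gaussBinom (q ^ 2) (2 * n) k * thetaTerm z q (k - n) := by
    have hinj : Function.Injective (fun k : ℕ => (k : ℤ) - n) := fun a b h => by simpa using h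
    rw [← hinj.tsum_eq]
    · refine tsum_congr fun k => ?_
      simp [tripleCoeff]
    · intro j hj
      by_contra hne
      apply hj
      have : ¬ (-(n : ℤ) ≤ j) := fun hle => hne ⟨(j + n).toNat, by simp; omega⟩
      simp [tripleCoeff, this]
  rw [h3, hsub, tsum_eq_sum (s := range (2 * n + 1)), mul_sum]
  · refine sum_congr rfl fun k _ => ?_
    have hc : (q ^ 2) ^ k.choose 2 * q ^ k = q ^ (k ^ 2) := by
      rw [← pow_mul, ← pow_add]
      congr 1
      have := Nat.choose_two_right k
      have h5 := Nat.div_mul_cancel (Nat.even_mul_pred_self k).two_dvd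
      rw [this, mul_comm, h5]
      cases k <;> simp; ring
    have hs : ((-1 : ℂ)) ^ ((k : ℤ) - n) = (-1) ^ n * (-1) ^ k := by
      rw [zpow_sub₀ (by norm_num), zpow_natCast, zpow_natCast]
      rcases neg_one_pow_eq_or ℂ n with h | h <;> rw [h] <;> simp [div_neg]
    have hqq : q ^ (((k : ℤ) - n) ^ 2) = q ^ (k ^ 2) * q ^ (n ^ 2) * (q ^ (2 * n * k))⁻¹ := by
      rw [show ((k : ℤ) - n) ^ 2 = ((k ^ 2 : ℕ) : ℤ) + ((n ^ 2 : ℕ) : ℤ)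
        - ((2 * n * k : ℕ) : ℤ) by push_cast; ring, zpow_sub₀ hq0, zpow_add₀ hq0]
      simp only [zpow_natCast, div_eq_mul_inv]
    rw [thetaTerm, hs, hqq, zpow_sub₀ hz, zpow_natCast, zpow_natCast, ← hc,
      neg_pow (z * q * (q ^ (2 * n))⁻¹) k, mul_pow, mul_pow, inv_pow, ← pow_mul]
    ring
  · intro k hk
    rw [gaussBinom_eq_zero _ (by simpa using hk), zero_mul]

lemma tripleCoeff_eq {q : ℂ} (hq : ‖q‖ < 1) {n : ℕ} {j : ℤ} (h : |j| ≤ n) :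
    tripleCoeff q n j
      = finPoch q q (2 * n) * (finPoch q q (n + j).toNat)⁻¹ * (finPoch q q (n - j).toNat)⁻¹ := by
  rw [abs_le] at h
  have hm := gaussBinom_mul q (n + j).toNat (n - j).toNat
  have e : (n + j).toNat + (n - j).toNat = 2 * n := by omega
  rw [e] at hm
  rw [tripleCoeff, if_pos h.1, ← hm, add_comm j]
  have h1 := finPoch_ne_zero hq hq (n + j).toNat
  have h2 := finPoch_ne_zero hq hq (n - j).toNat
  field_simp

lemma tripleCoeff_eq_zero (q : ℂ) {n : ℕ} {j : ℤ} (h : ¬ |j| ≤ n) : tripleCoeff q n j = 0 := by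
  rw [abs_le] at h
  rw [tripleCoeff]
  split_ifs with h1
  · exact gaussBinom_eq_zero q (by omega)
  · rfl

lemma tendsto_tripleCoeff {q : ℂ} (hq : ‖q‖ < 1) (j : ℤ) :
    Tendsto (fun n => tripleCoeff q n j) atTop (𝓝 (poch q q)⁻¹) := by
  have hP := poch_ne_zero hq hq
  have ht := tendsto_finPoch q hq
  have ha : Tendsto (fun n : ℕ => 2 * n) atTop atTop :=
    tendsto_atTop_mono (fun n => by simp; omega) tendsto_id
  have hb (i : ℤ) : Tendsto (fun n : ℕ => ((n : ℤ) + i).toNat) atTop atTop :=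
    tendsto_atTop.mpr fun b => (eventually_ge_atTop (b + i.natAbs)).mono fun n hn => by omega
  have h := ((ht.comp ha).mul ((ht.comp (hb j)).inv₀ hP)).mul ((ht.comp (hb (-j))).inv₀ hP)
  rw [mul_inv_cancel₀ hP, one_mul] at h
  refine h.congr' ((eventually_ge_atTop j.natAbs).mono fun n hn => ?_)
  simp only [Function.comp_apply, tripleCoeff_eq hq (abs_le.mpr ⟨by omega, by omega⟩ : |j| ≤ (n : ℤ)),
    ← sub_eq_add_neg]

lemma exists_norm_tripleCoeff_le {q : ℂ} (hq : ‖q‖ < 1) :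
    ∃ C, ∀ n j, ‖tripleCoeff q n j‖ ≤ C := by
  have ht := tendsto_finPoch q hq
  obtain ⟨A, hA⟩ := ht.norm.bddAbove_range
  obtain ⟨B, hB⟩ := (ht.inv₀ (poch_ne_zero hq hq)).norm.bddAbove_range
  have hA' (n) : ‖finPoch q q n‖ ≤ A := hA ⟨n, rfl⟩
  have hB' (n) : ‖(finPoch q q n)⁻¹‖ ≤ B := hB ⟨n, rfl⟩
  have hA0 : 0 ≤ A := (norm_nonneg _).trans (hA' 0)
  have hB0 : 0 ≤ B := (norm_nonneg _).trans (hB' 0)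
  refine ⟨A * B * B, fun n j => ?_⟩
  by_cases h : |j| ≤ n
  · rw [tripleCoeff_eq hq h, norm_mul, norm_mul]
    gcongr
    exacts [hA' _, hB' _, hB' _]
  · rw [tripleCoeff_eq_zero q h, norm_zero]
    positivity

/-- The **Jacobi triple product** identity. -/
theorem jacobi_triple_product {z q : ℂ} (hz : z ≠ 0) (hq0 : q ≠ 0) (hq : ‖q‖ < 1) :
    poch (z * q) (q ^ 2) * poch (z⁻¹ * q) (q ^ 2) * poch (q ^ 2) (q ^ 2)
      = ∑' n, thetaTerm z q n := by
  have hq2 := norm_pow_lt_one hq two_ne_zero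
  obtain ⟨C, hC⟩ := exists_norm_tripleCoeff_le hq2
  have hlim := tendsto_tsum_of_dominated_convergence (𝓕 := atTop)
    (f := fun n j => tripleCoeff (q ^ 2) n j * thetaTerm z q j)
    (g := fun j => (poch (q ^ 2) (q ^ 2))⁻¹ * thetaTerm z q j)
    (((summable_thetaTerm hz hq0 hq).norm).mul_left C)
    (fun j => (tendsto_tripleCoeff hq2 j).mul_const _)
    (Eventually.of_forall fun n j => by
      rw [norm_mul]; gcongr; exact hC n j)
  have hprod := (tendsto_finPoch (z * q) hq2).mul (tendsto_finPoch (z⁻¹ * q) hq2)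
  have := tendsto_nhds_unique (hprod.congr (finPoch_mul_finPoch hz hq0)) hlim
  rw [this, tsum_mul_left, mul_comm, mul_inv_cancel_left₀ (poch_ne_zero hq2 hq2)]

lemma thetaTerm_mul_three (q : ℂ) (m : ℤ) :
    thetaTerm 1 q (m * 3) = thetaTerm 1 (q ^ 9) m := by
  have h1 : (-1 : ℂ) ^ (m * 3) = (-1) ^ m := by rw [mul_comm, zpow_mul]; norm_num
  have h2 : q ^ ((m * 3) ^ 2) = (q ^ 9) ^ (m ^ 2) := by
    rw [← zpow_natCast, ← zpow_mul]; congr 1; push_cast; ring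
  simp only [thetaTerm, one_zpow, mul_one, h1, h2]

lemma thetaTerm_one_add {q : ℂ} (hq0 : q ≠ 0) (m : ℤ) :
    thetaTerm 1 q (1 + m * 3) = -q * thetaTerm (q ^ 6) (q ^ 9) m := by
  have h1 : (-1 : ℂ) ^ (1 + m * 3) = -(-1) ^ m := by
    rw [zpow_add₀ (by norm_num), mul_comm m, zpow_mul]; norm_num
  have h2 : q ^ ((1 + m * 3) ^ 2) = q * ((q ^ 6) ^ m * (q ^ 9) ^ (m ^ 2)) := by
    rw [← zpow_natCast, ← zpow_natCast, ← zpow_mul, ← zpow_mul, ← zpow_add₀ hq0,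
      ← zpow_one_add₀ hq0]
    congr 1; push_cast; ring
  simp only [thetaTerm, one_zpow, mul_one, h1, h2]
  ring

lemma thetaTerm_one_neg (q : ℂ) (m : ℤ) : thetaTerm 1 q (-m) = thetaTerm 1 q m := by
  have h : (-1 : ℂ) ^ (-m) = (-1) ^ m := by rw [zpow_neg, ← inv_zpow]; norm_num
  simp only [thetaTerm, one_zpow, mul_one, h, neg_sq]

lemma thetaTerm_two_add {q : ℂ} (hq0 : q ≠ 0) (m : ℤ) :
    thetaTerm 1 q (2 + m * 3) = -q * thetaTerm (q ^ 6) (q ^ 9) (-1 - m) := by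
  rw [← thetaTerm_one_add hq0, ← thetaTerm_one_neg]
  congr 1
  ring

lemma tsum_int_eq_three {f : ℤ → ℂ} (hf : Summable f) :
    ∑' n, f n = ∑' m : ℤ, (f (m * 3) + f (1 + m * 3) + f (2 + m * 3)) := by
  rw [← (Int.divModEquiv 3).symm.tsum_eq,
    Summable.tsum_prod (f := fun p => f ((Int.divModEquiv 3).symm p))
      ((Int.divModEquiv 3).symm.summable_iff.mpr hf)]
  refine tsum_congr fun m => ?_
  simp [tsum_fintype, Fin.sum_univ_three, Int.divModEquiv, add_comm]

/-- The 3-dissection of the alternating theta series. -/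
lemma tsum_thetaTerm_dissection {q : ℂ} (hq0 : q ≠ 0) (hq : ‖q‖ < 1) :
    ∑' n, thetaTerm 1 q n
      = ∑' n, thetaTerm 1 (q ^ 9) n - 2 * q * ∑' n, thetaTerm (q ^ 6) (q ^ 9) n := by
  have hq9 := norm_pow_lt_one hq (show 9 ≠ 0 by norm_num)
  have sa := summable_thetaTerm one_ne_zero (pow_ne_zero 9 hq0) hq9
  have sb := summable_thetaTerm (pow_ne_zero 6 hq0) (pow_ne_zero 9 hq0) hq9
  rw [tsum_int_eq_three (summable_thetaTerm one_ne_zero hq0 hq)]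
  simp only [thetaTerm_mul_three, thetaTerm_one_add hq0, thetaTerm_two_add hq0]
  generalize thetaTerm 1 (q ^ 9) = f at *
  generalize thetaTerm (q ^ 6) (q ^ 9) = g at *
  have sb' : Summable fun m => g (-1 - m) := (Equiv.subLeft (-1 : ℤ)).summable_iff.mpr sb
  have hg : ∑' m, g (-1 - m) = ∑' m, g m := (Equiv.subLeft (-1 : ℤ)).tsum_eq g
  rw [(sa.add (sb.mul_left _)).tsum_add (sb'.mul_left _), sa.tsum_add (sb.mul_left _),
    tsum_mul_left, tsum_mul_left, hg]
  ring

lemma poch_mul_self_eq_tsum {q : ℂ} (hq0 : q ≠ 0) (hq : ‖q‖ < 1) :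
    poch q (q ^ 2) * poch q (q ^ 2) * poch (q ^ 2) (q ^ 2) = ∑' n, thetaTerm 1 q n := by
  simpa using jacobi_triple_product one_ne_zero hq0 hq

lemma Jam_nine_eq_tsum {q : ℂ} (hq0 : q ≠ 0) (hq : ‖q‖ < 1) :
    Jam 9 18 q = ∑' n, thetaTerm 1 (q ^ 9) n := by
  rw [← poch_mul_self_eq_tsum (pow_ne_zero 9 hq0) (norm_pow_lt_one hq (by norm_num)), Jam,
    ← pow_mul]

lemma Jam_three_eq_tsum {q : ℂ} (hq0 : q ≠ 0) (hq : ‖q‖ < 1) :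
    Jam 3 18 q = ∑' n, thetaTerm (q ^ 6) (q ^ 9) n := by
  rw [← jacobi_triple_product (pow_ne_zero 6 hq0) (pow_ne_zero 9 hq0)
    (norm_pow_lt_one hq (by norm_num)), Jam, ← pow_mul, ← pow_add,
    show (q ^ 6)⁻¹ * q ^ 9 = q ^ 3 by field_simp]
  ring

lemma poch_odd_mul_poch_even {q : ℂ} (hq : ‖q‖ < 1) :
    poch q (q ^ 2) * poch (q ^ 2) (q ^ 2) = poch q q := by
  rw [poch_dissection q hq two_ne_zero]
  simp [prod_range_succ, ← sq]

/-- The 3-dissection of the theta quotient `(q;q)_∞² / (q²;q²)_∞`. -/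
lemma poch_sq_eq {q : ℂ} (hq0 : q ≠ 0) (hq : ‖q‖ < 1) :
    poch q q ^ 2 = (Jam 9 18 q - 2 * q * Jam 3 18 q) * poch (q ^ 2) (q ^ 2) := by
  rw [Jam_nine_eq_tsum hq0 hq, Jam_three_eq_tsum hq0 hq, ← tsum_thetaTerm_dissection hq0 hq,
    ← poch_mul_self_eq_tsum hq0 hq, ← poch_odd_mul_poch_even hq]
  ring

lemma Jam_nine_mul {q : ℂ} (hq : ‖q‖ < 1) :
    Jam 9 18 q * poch (q ^ 18) (q ^ 18) = poch (q ^ 9) (q ^ 9) ^ 2 := by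
  rw [Jam, ← poch_odd_mul_poch_even (norm_pow_lt_one hq (show 9 ≠ 0 by norm_num)), ← pow_mul]
  ring

lemma Jam_three_mul {q : ℂ} (hq : ‖q‖ < 1) :
    Jam 3 18 q * poch (q ^ 9) (q ^ 9) * poch (q ^ 6) (q ^ 6)
      = poch (q ^ 3) (q ^ 3) * poch (q ^ 18) (q ^ 18) ^ 2 := by
  rw [Jam, ← poch_odd_mul_poch_even (norm_pow_lt_one hq (show 9 ≠ 0 by norm_num)),
    ← poch_odd_mul_poch_even (norm_pow_lt_one hq (show 3 ≠ 0 by norm_num)), ← pow_mul, ← pow_mul,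
    poch_dissection (q ^ 3) (norm_pow_lt_one hq (show 3 * 2 ≠ 0 by norm_num)) three_ne_zero]
  simp only [prod_range_succ, prod_range_zero, ← pow_mul, ← pow_add]
  ring

lemma poch_self_mul_cube_roots {q w : ℂ} (hq : ‖q‖ < 1) (hw : 1 + w + w ^ 2 = 0) :
    poch q q * poch (w * q) (w * q) * poch (w ^ 2 * q) (w ^ 2 * q) * poch (q ^ 9) (q ^ 9)
      = poch (q ^ 3) (q ^ 3) ^ 4 := by
  have hw3 : w ^ 3 = 1 := by linear_combination (w - 1) * hw
  have hwn : ‖w‖ = 1 := by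
    simpa [pow_eq_one_iff_of_nonneg] using congrArg norm hw3
  have h3 {x : ℂ} (hx : ‖x‖ < 1) :
      poch x x = poch x (x ^ 3) * poch (x ^ 2) (x ^ 3) * poch (x ^ 3) (x ^ 3) := by
    rw [poch_dissection x hx three_ne_zero]
    simp [prod_range_succ, ← pow_succ']
  have e1 : (w * q) ^ 3 = q ^ 3 := by rw [mul_pow, hw3, one_mul]
  have e2 : (w ^ 2 * q) ^ 3 = q ^ 3 := by linear_combination (q ^ 3 * (w ^ 3 + 1)) * hw3
  have e3 : (w ^ 2 * q) ^ 2 = w * q ^ 2 := by linear_combination (q ^ 2 * w) * hw3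
  have hq3 := norm_pow_lt_one hq three_ne_zero
  have k1 := poch_mul_cube_roots q hq3 hw
  have k2 := poch_mul_cube_roots (q ^ 2) hq3 hw
  have k3 := h3 hq3
  simp only [← pow_mul] at k1 k2 k3
  norm_num at k1 k2 k3
  rw [h3 hq, h3 (x := w * q) (by simpa [hwn]), h3 (x := w ^ 2 * q) (by simpa [hwn]),
    e1, e2, e3, mul_pow w q 2]
  have k4 : poch (q ^ 3) (q ^ 3) ^ 4
      = poch (q ^ 3) (q ^ 9) * poch (q ^ 6) (q ^ 9) * poch (q ^ 9) (q ^ 9)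
        * poch (q ^ 3) (q ^ 3) ^ 3 := by rw [← k3]; ring
  rw [k4, ← k1, ← k2]
  ring

lemma Jam_eq_of_cube_eq {a m : ℕ} {x y : ℂ} (h : x ^ 3 = y ^ 3) (ha : 3 ∣ a) (hm : 3 ∣ m) :
    Jam a m x = Jam a m y := by
  have key {n : ℕ} (hn : 3 ∣ n) : x ^ n = y ^ n := by
    obtain ⟨k, rfl⟩ := hn
    rw [pow_mul, pow_mul, h]
  rw [Jam, Jam, key ha, key hm, key (Nat.dvd_sub hm ha)]

/-- The product of the 3-dissection over the three cube roots of unity. -/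
lemma Jam_cube_sub {q : ℂ} (hq0 : q ≠ 0) (hq : ‖q‖ < 1) :
    (Jam 9 18 q ^ 3 - 8 * q ^ 3 * Jam 3 18 q ^ 3) * poch (q ^ 6) (q ^ 6) ^ 4
        * poch (q ^ 9) (q ^ 9) ^ 2
      = poch (q ^ 3) (q ^ 3) ^ 8 * poch (q ^ 18) (q ^ 18) := by
  obtain ⟨w, hw⟩ : ∃ w : ℂ, 1 + w + w ^ 2 = 0 := by
    obtain ⟨w, hw⟩ := IsAlgClosed.exists_pow_nat_eq (-3 / 4 : ℂ) two_pos
    exact ⟨w - 1 / 2, by linear_combination hw⟩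
  have hw3 : w ^ 3 = 1 := by linear_combination (w - 1) * hw
  have hwn : ‖w‖ = 1 := by
    simpa [pow_eq_one_iff_of_nonneg] using congrArg norm hw3
  have hw0 : w ≠ 0 := norm_ne_zero_iff.mp (by rw [hwn]; exact one_ne_zero)
  have e1 : (w * q) ^ 3 = q ^ 3 := by rw [mul_pow, hw3, one_mul]
  have e2 : (w ^ 2 * q) ^ 3 = q ^ 3 := by linear_combination (q ^ 3 * (w ^ 3 + 1)) * hw3
  have hq2 := norm_pow_lt_one hq two_ne_zero
  have p0 := poch_sq_eq hq0 hq
  have p1 := poch_sq_eq (q := w * q) (mul_ne_zero hw0 hq0) (by simpa [hwn])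
  have p2 := poch_sq_eq (q := w ^ 2 * q) (by simp [hw0, hq0]) (by simpa [hwn])
  have r1 := poch_self_mul_cube_roots hq hw
  have r2 := poch_self_mul_cube_roots hq2 (w := w ^ 2) (by
    linear_combination hw + w * hw3)
  rw [show (w ^ 2) ^ 2 * q ^ 2 = (w ^ 2 * q) ^ 2 by ring, ← mul_pow, ← pow_mul, ← pow_mul] at r2
  rw [Jam_eq_of_cube_eq e1 (by norm_num) (by norm_num),
    Jam_eq_of_cube_eq e1 (by norm_num) (by norm_num)] at p1
  rw [Jam_eq_of_cube_eq e2 (by norm_num) (by norm_num),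
    Jam_eq_of_cube_eq e2 (by norm_num) (by norm_num)] at p2
  have hprod : Jam 9 18 q ^ 3 - 8 * q ^ 3 * Jam 3 18 q ^ 3
      = (Jam 9 18 q - 2 * q * Jam 3 18 q) * (Jam 9 18 q - 2 * (w * q) * Jam 3 18 q)
        * (Jam 9 18 q - 2 * (w ^ 2 * q) * Jam 3 18 q) := by
    generalize Jam 9 18 q = a
    generalize Jam 3 18 q = b
    linear_combination (2 * q * a ^ 2 * b - 4 * w * q ^ 2 * a * b ^ 2
      + 8 * (w - 1) * q ^ 3 * b ^ 3) * hw
  norm_num only at r2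
  rw [hprod, ← r2, show poch (q ^ 3) (q ^ 3) ^ 8 = (poch (q ^ 3) (q ^ 3) ^ 4) ^ 2 by ring, ← r1]
  rw [mul_pow _ (poch (q ^ 9) _), mul_pow _ (poch (w ^ 2 * q) _), mul_pow (poch q q), p0, p1, p2]
  ring

theorem stmt8 (q : ℂ) (hq0 : 0 < ‖q‖) (hq : ‖q‖ < 1) :
    poch (-q) q / poch q q
      = (Jm 18 q) ^ 12 / ((Jam 3 18 q) ^ 8 * (Jm 6 q) ^ 4 * Jam 9 18 q)
        + 2 * q * (Jm 18 q) ^ 12 / ((Jam 3 18 q) ^ 7 * (Jm 6 q) ^ 4 * (Jam 9 18 q) ^ 2)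
        + 4 * q ^ 2 * (Jm 18 q) ^ 12 / ((Jam 3 18 q) ^ 6 * (Jm 6 q) ^ 4 * (Jam 9 18 q) ^ 3) := by
  have hq0' : q ≠ 0 := norm_pos_iff.mp hq0
  have hE {m : ℕ} (hm : m ≠ 0) : poch (q ^ m) (q ^ m) ≠ 0 :=
    poch_ne_zero (norm_pow_lt_one hq hm) (norm_pow_lt_one hq hm)
  have h1 : poch q q ≠ 0 := poch_ne_zero hq hq
  have h2 := hE two_ne_zero
  have h3 := hE three_ne_zero
  have h6 := hE (m := 6) (by norm_num)
  have h9 := hE (m := 9) (by norm_num)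
  have h18 := hE (m := 18) (by norm_num)
  have ha := Jam_nine_mul hq
  have hb := Jam_three_mul hq
  have hab := Jam_cube_sub hq0' hq
  have hsq := poch_sq_eq hq0' hq
  have hneg := poch_mul_poch_neg q hq
  simp only [Jm]
  generalize poch (q ^ 18) (q ^ 18) = E18 at *
  generalize poch (q ^ 9) (q ^ 9) = E9 at *
  generalize poch (q ^ 6) (q ^ 6) = E6 at *
  generalize poch (q ^ 3) (q ^ 3) = E3 at *
  generalize poch (q ^ 2) (q ^ 2) = E2 at *
  generalize Jam 9 18 q = a at *
  generalize Jam 3 18 q = b at *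
  have ha0 : a ≠ 0 := left_ne_zero_of_mul (ha ▸ pow_ne_zero 2 h9)
  have hb0 : b ≠ 0 := left_ne_zero_of_mul
    (left_ne_zero_of_mul (hb ▸ mul_ne_zero h3 (pow_ne_zero 2 h18)))
  have hphi : a - 2 * q * b ≠ 0 := fun h => by simp [h, h1] at hsq
  have hL : poch (-q) q / poch q q = 1 / (a - 2 * q * b) := by
    rw [div_eq_div_iff h1 hphi]
    refine mul_left_cancel₀ (mul_ne_zero h1 h2) ?_
    linear_combination (E2 * (a - 2 * q * b)) * hneg - E2 * hsq
  have key : E18 ^ 12 * (a ^ 3 - 8 * q ^ 3 * b ^ 3) = b ^ 8 * E6 ^ 4 * a ^ 3 := by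
    have ea : a = E9 ^ 2 / E18 := by rw [eq_div_iff h18, ha]
    have eb : b = E3 * E18 ^ 2 / (E9 * E6) := by
      rw [eq_div_iff (mul_ne_zero h9 h6), ← hb]; ring
    have ec : a ^ 3 - 8 * q ^ 3 * b ^ 3 = E3 ^ 8 * E18 / (E6 ^ 4 * E9 ^ 2) := by
      rw [eq_div_iff (by positivity), ← hab]; ring
    rw [ec, ea, eb]
    field_simp
  rw [hL]
  have hsum : E18 ^ 12 / (b ^ 8 * E6 ^ 4 * a) + 2 * q * E18 ^ 12 / (b ^ 7 * E6 ^ 4 * a ^ 2)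
      + 4 * q ^ 2 * E18 ^ 12 / (b ^ 6 * E6 ^ 4 * a ^ 3)
      = E18 ^ 12 * (a ^ 2 + 2 * q * a * b + 4 * q ^ 2 * b ^ 2) / (b ^ 8 * E6 ^ 4 * a ^ 3) := by
    field_simp
  rw [hsum, div_eq_div_iff hphi (by simp [ha0, hb0, h6])]
  linear_combination -key
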